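/- Let H = {1, 29, 37} ⊆ Z_67, a subgroup of order 3 of Z_67^*, and set X1 = ⋃_{j ∈ J} H·j, X2 = ⋃_{k ∈ K} H·k, X3 = ⋃_{l ∈ L} H·l, where J = {0,1,4,5,6,8,10,16,18,23,27}, K = {0,1,2,3,4,5,12,15,32,34}, L = {0,2,3,4,5,8,10,18,23,30}. Then (X1, X2, X3) is a supplementary difference set in Z_67 with parameters (67; 31, 28, 28; 37). -/

import Mathlib

/-- Number of `b < n` with both `b` and `b + c` (mod 67) in the set coded by the bits of `m`. -/
def cnt (m c : ℕ) : ℕ → ℕ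
  | 0 => 0
  | n + 1 => cnt m c n + (m.testBit n && m.testBit ((n + c) % 67)).toNat

theorem cnt_eq (m c n : ℕ) :
    cnt m c n = ∑ b ∈ Finset.range n, (m.testBit b && m.testBit ((b + c) % 67)).toNat := by
  induction n with
  | zero => rfl
  | succ n ih => rw [Finset.sum_range_succ, ← ih]; rfl

theorem card_diff (X : Finset (ZMod 67)) (m : ℕ)
    (h : ∀ x : ZMod 67, x ∈ X ↔ m.testBit x.val = true) (c : ZMod 67) :
    ((X ×ˢ X).filter (fun p => p.1 - p.2 = c)).card = cnt m c.val 67 := by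
  have h1 : ((X ×ˢ X).filter (fun p => p.1 - p.2 = c)).card
      = (Finset.univ.filter (fun b : ZMod 67 => b ∈ X ∧ b + c ∈ X)).card := by
    refine Finset.card_bij' (fun p _ => p.2) (fun b _ => (b + c, b)) ?_ ?_ ?_ ?_
    · rintro ⟨a, b⟩ hp
      simp only [Finset.mem_filter, Finset.mem_product] at hp
      obtain ⟨⟨ha, hb⟩, rfl⟩ := hp
      simp [ha, hb]
    · intro b hb
      simp only [Finset.mem_filter, Finset.mem_univ, true_and] at hb
      simp [hb.1, hb.2]
    · rintro ⟨a, b⟩ hp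
      simp only [Finset.mem_filter, Finset.mem_product] at hp
      simp [← hp.2]
    · intro b hb
      rfl
  rw [h1, cnt_eq, Finset.card_filter,
    ← Fin.sum_univ_eq_sum_range
      (fun b => (m.testBit b && m.testBit ((b + c.val) % 67)).toNat) 67]
  refine Finset.sum_congr rfl fun b _ => ?_
  have hb := h b
  have hbc := h (b + c)
  rw [ZMod.val_add] at hbc
  change b ∈ X ↔ m.testBit (Fin.val (n := 67) b) = true at hb
  change b + c ∈ X ↔ m.testBit ((Fin.val (n := 67) b + c.val) % 67) = true at hbc
  by_cases h2 : b ∈ X <;> by_cases h3 : b + c ∈ X <;> simp_all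

theorem cnt_total : ∀ c < 67, c ≠ 0 →
    cnt 34671737061910072691 c 67 + cnt 440002731245631679 c 67 +
      cnt 101757303372991712701 c 67 = 37 := by
  decide +kernel


/-- Supplementary difference set predicate (see paper's Definition 1). -/
def IsSDS (v t : ℕ) (X : Fin t → Finset (ZMod v)) (k : Fin t → ℕ) (lam : ℤ) : Prop :=
  (∀ i, (X i).card = k i) ∧
  ∀ c : ZMod v, c ≠ 0 →
    ((∑ i, (((X i) ×ˢ (X i)).filter (fun p => p.1 - p.2 = c)).card : ℕ) : ℤ) = lam

/-- The unions of orbits of the order-3 subgroup `H = {1, 29, 37}` of `(ZMod 67)ˣ` over the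
listed representative sets form an SDS with parameters `(67; 31, 28, 28; 37)`. -/
theorem sds_67 :
    let H : Finset (ZMod 67) := {1, 29, 37}
    let J : Finset (ZMod 67) := {0, 1, 4, 5, 6, 8, 10, 16, 18, 23, 27}
    let K : Finset (ZMod 67) := {0, 1, 2, 3, 4, 5, 12, 15, 32, 34}
    let L : Finset (ZMod 67) := {0, 2, 3, 4, 5, 8, 10, 18, 23, 30}
    IsSDS 67 3
      ![J.biUnion (fun j => H.image (fun h => h * j)),
        K.biUnion (fun k => H.image (fun h => h * k)),
        L.biUnion (fun l => H.image (fun h => h * l))]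
      ![31, 28, 28] 37 := by
  intro H J K L
  refine ⟨by decide +kernel, fun c hc => ?_⟩
  rw [Fin.sum_univ_three]
  have e1 := card_diff (J.biUnion (fun j => H.image (fun h => h * j))) 34671737061910072691
    (by decide +kernel) c
  have e2 := card_diff (K.biUnion (fun k => H.image (fun h => h * k))) 440002731245631679
    (by decide +kernel) c
  have e3 := card_diff (L.biUnion (fun l => H.image (fun h => h * l))) 101757303372991712701
    (by decide +kernel) c
  have e := cnt_total c.val (ZMod.val_lt c) ((ZMod.val_ne_zero c).2 hc)
  rw [← e1, ← e2, ← e3] at e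
  exact congrArg (Nat.cast : ℕ → ℤ) e
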